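/- arXiv:2004.11770 — 2 statements merged into one kernel-verified Lean document; each statement's English description precedes it below -/
import Mathlib

section
/- Let μ be the probability measure on ℝ² with density f(x,y) = 1/(2π√(1−x²−y²)) on the open unit disk {x²+y² < 1} (and 0 elsewhere). Then both coordinate marginals of μ are the uniform distribution on [−1,1], and if (X₁,X₂) and (Y₁,Y₂) are independent with law μ, then E‖(X₁,X₂)−(Y₁,Y₂)‖₂ = π/3. Consequently the copula C° obtained from μ by the coordinatewise rescaling x ↦ (x+1)/2 satisfies S(C°,C°) = π/6, so the bound S(C,C) ≤ π/6 for bivariate copulas is sharp. -/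
open MeasureTheory Set
open scoped ENNReal

/-- The Euclidean distance `‖x - y‖₂` on `ℝ^d`. -/
noncomputable def dist2 {d : ℕ} (x y : Fin d → ℝ) : ℝ := Real.sqrt (∑ i, (x i - y i) ^ 2)

/-- `S(F,G) = ∫∫ ‖x-y‖₂ F(dx) G(dy)`. -/
noncomputable def S (d : ℕ) (F G : Measure (Fin d → ℝ)) : ℝ :=
  ∫ x, ∫ y, dist2 x y ∂G ∂F

/-- The measure on `ℝ²` with density `1/(2π√(1-x²-y²))` on the open unit disk. -/
noncomputable def diskLaw : Measure (Fin 2 → ℝ) :=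
  volume.withDensity (fun x =>
    if (x 0) ^ 2 + (x 1) ^ 2 < 1 then
      ENNReal.ofReal (1 / (2 * Real.pi * Real.sqrt (1 - (x 0) ^ 2 - (x 1) ^ 2)))
    else 0)

/-- The uniform distribution on `[-1,1]`. -/
noncomputable def uniformSymm : Measure ℝ := (2 : ℝ≥0∞)⁻¹ • volume.restrict (Set.Icc (-1) 1)

/-- The spherical symmetric copula `C°`: the pushforward of `diskLaw` under the
coordinatewise rescaling `x ↦ (x+1)/2`. -/
noncomputable def CCirc2 : Measure (Fin 2 → ℝ) :=
  Measure.map (fun x : Fin 2 → ℝ => fun i => (x i + 1) / 2) diskLaw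

noncomputable def dens (x : Fin 2 → ℝ) : ℝ≥0∞ :=
    if (x 0) ^ 2 + (x 1) ^ 2 < 1 then
      ENNReal.ofReal (1 / (2 * Real.pi * Real.sqrt (1 - (x 0) ^ 2 - (x 1) ^ 2)))
    else 0

lemma dens_meas : Measurable dens := by
  unfold dens
  apply Measurable.ite
  · exact measurableSet_lt (by fun_prop) (by fun_prop)
  · fun_prop
  · fun_prop

lemma diskLaw_eq : diskLaw = volume.withDensity dens := rfl

/-- The projection onto direction `θ`. -/
noncomputable def proj (θ : ℝ) (x : Fin 2 → ℝ) : ℝ := Real.cos θ * x 0 + Real.sin θ * x 1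

noncomputable def rot (θ : ℝ) : Matrix (Fin 2) (Fin 2) ℝ :=
  !![Real.cos θ, Real.sin θ; - Real.sin θ, Real.cos θ]

lemma rot_det (θ : ℝ) : (rot θ).det = 1 := by
  simp [rot, Matrix.det_fin_two]
  nlinarith [Real.sin_sq_add_cos_sq θ]

lemma rot_zero (θ : ℝ) (x : Fin 2 → ℝ) : Matrix.toLin' (rot θ) x 0 = proj θ x := by
  simp [rot, proj, Matrix.mulVec, dotProduct]

lemma rot_one (θ : ℝ) (x : Fin 2 → ℝ) :
    Matrix.toLin' (rot θ) x 1 = - Real.sin θ * x 0 + Real.cos θ * x 1 := by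
  simp [rot, Matrix.mulVec, dotProduct]

lemma rot_dens (θ : ℝ) (x : Fin 2 → ℝ) : dens (Matrix.toLin' (rot θ) x) = dens x := by
  have h : (Matrix.toLin' (rot θ) x 0) ^ 2 + (Matrix.toLin' (rot θ) x 1) ^ 2
      = x 0 ^ 2 + x 1 ^ 2 := by
    rw [rot_zero, rot_one, proj]
    linear_combination (x 0 ^ 2 + x 1 ^ 2) * Real.sin_sq_add_cos_sq θ
  unfold dens
  rw [sub_sub, sub_sub, h]

lemma rot_meas (θ : ℝ) : Measurable (Matrix.toLin' (rot θ)) :=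
  (LinearMap.continuous_of_finiteDimensional _).measurable

lemma rot_map_vol (θ : ℝ) :
    Measure.map (Matrix.toLin' (rot θ)) (volume : Measure (Fin 2 → ℝ)) = volume := by
  rw [Real.map_matrix_volume_pi_eq_smul_volume_pi (by rw [rot_det]; norm_num), rot_det]
  simp

lemma rot_map (θ : ℝ) : Measure.map (Matrix.toLin' (rot θ)) diskLaw = diskLaw := by
  ext s hs
  rw [Measure.map_apply (rot_meas θ) hs, diskLaw_eq, withDensity_apply _ hs,
    withDensity_apply _ (rot_meas θ hs)]
  conv_rhs => rw [← rot_map_vol θ]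
  rw [setLIntegral_map hs dens_meas (rot_meas θ)]
  simp_rw [rot_dens]

lemma inner_int (a : ℝ) (ha : 0 < a) :
    ∫⁻ y in Ioo (-a) a, ENNReal.ofReal (1 / (2 * Real.pi * Real.sqrt (a ^ 2 - y ^ 2)))
      = 2⁻¹ := by
  have him : (fun t => a * Real.sin t) '' Ioo (-(Real.pi / 2)) (Real.pi / 2) = Ioo (-a) a := by
    ext y
    constructor
    · rintro ⟨t, ht, rfl⟩
      have h1 : Real.sin t < 1 := by
        have := Real.strictMonoOn_sin (Ioo_subset_Icc_self ht)
          (right_mem_Icc.2 (by linarith [Real.pi_pos])) ht.2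
        simpa using this
      have h2 : -1 < Real.sin t := by
        have := Real.strictMonoOn_sin (left_mem_Icc.2 (by linarith [Real.pi_pos]))
          (Ioo_subset_Icc_self ht) ht.1
        simpa using this
      constructor <;> simp only <;> nlinarith
    · intro hy
      have h1 : y / a < 1 := by rw [div_lt_one ha]; exact hy.2
      have h2 : -1 < y / a := by rw [lt_div_iff₀ ha]; linarith [hy.1]
      refine ⟨Real.arcsin (y / a), ⟨?_, ?_⟩, ?_⟩
      · exact Real.neg_pi_div_two_lt_arcsin.2 h2
      · exact Real.arcsin_lt_pi_div_two.2 h1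
      · simp only
        rw [Real.sin_arcsin h2.le h1.le]; field_simp
  rw [← him, lintegral_image_eq_lintegral_abs_deriv_mul measurableSet_Ioo
    (f' := fun t => a * Real.cos t)
    (fun t _ => ((Real.hasDerivAt_sin t).const_mul a).hasDerivWithinAt)]
  · have : ∀ t ∈ Ioo (-(Real.pi / 2)) (Real.pi / 2), ENNReal.ofReal |a * Real.cos t| *
        ENNReal.ofReal (1 / (2 * Real.pi * Real.sqrt (a ^ 2 - (a * Real.sin t) ^ 2)))
        = ENNReal.ofReal (1 / (2 * Real.pi)) := by
      intro t ht
      have hc := Real.cos_pos_of_mem_Ioo ht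
      have h1 : a ^ 2 - (a * Real.sin t) ^ 2 = (a * Real.cos t) ^ 2 := by
        linear_combination (-a ^ 2) * Real.sin_sq_add_cos_sq t
      have hp := mul_pos ha hc
      rw [h1, Real.sqrt_sq hp.le, abs_of_pos hp, ← ENNReal.ofReal_mul hp.le]
      congr 1
      field_simp
    rw [setLIntegral_congr_fun measurableSet_Ioo this]
    rw [lintegral_const, Measure.restrict_apply_univ, Real.volume_Ioo,
      ← ENNReal.ofReal_mul (by positivity)]
    have : 1 / (2 * Real.pi) * (Real.pi / 2 - -(Real.pi / 2)) = (2:ℝ)⁻¹ := by field_simp; ring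
    rw [this, ENNReal.ofReal_inv_of_pos (by norm_num)]; simp
  · intro s hs t ht h
    exact Real.injOn_sin (Ioo_subset_Icc_self hs) (Ioo_subset_Icc_self ht)
      (mul_left_cancel₀ ha.ne' h)

lemma inner_dens (x : ℝ) (hx : x ^ 2 < 1) : ∫⁻ y, dens ![x, y] = 2⁻¹ := by
  have ha : 0 < Real.sqrt (1 - x ^ 2) := Real.sqrt_pos.2 (by linarith)
  rw [← inner_int _ ha, ← lintegral_indicator measurableSet_Ioo]
  congr 1
  ext y
  have hm : y ∈ Ioo (-Real.sqrt (1 - x ^ 2)) (Real.sqrt (1 - x ^ 2)) ↔ x ^ 2 + y ^ 2 < 1 := by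
    rw [mem_Ioo, ← abs_lt, Real.lt_sqrt (abs_nonneg _), sq_abs]
    constructor <;> intro h <;> linarith
  simp only [dens, indicator, hm, Real.sq_sqrt (show 0 ≤ 1 - x ^ 2 by linarith)]
  simp

lemma inner_dens' (x : ℝ) (hx : ¬ x ^ 2 < 1) : ∫⁻ y, dens ![x, y] = 0 := by
  have : ∀ y, dens ![x, y] = 0 := by
    intro y
    simp only [dens]
    rw [if_neg]
    simp
    nlinarith [sq_nonneg y]
  simp [this]

lemma marg0 : Measure.map (fun x => x 0) diskLaw = uniformSymm := by
  have hd : Measurable (fun p : ℝ × ℝ => dens ![p.1, p.2]) := by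
    refine dens_meas.comp ?_
    exact (MeasurableEquiv.finTwoArrow (α := ℝ)).symm.measurable
  ext s hs
  have hs' : MeasurableSet ((fun x : Fin 2 → ℝ => x 0) ⁻¹' s) := (measurable_pi_apply 0) hs
  rw [Measure.map_apply (measurable_pi_apply 0) hs, diskLaw_eq, withDensity_apply _ hs',
    ← lintegral_indicator hs']
  rw [← ((volume_preserving_finTwoArrow ℝ).symm _).lintegral_comp (dens_meas.indicator hs')]
  have h1 : ∀ p : ℝ × ℝ, ((fun x : Fin 2 → ℝ => x 0) ⁻¹' s).indicator dens
      (MeasurableEquiv.finTwoArrow.symm p)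
      = s.indicator 1 p.1 * dens ![p.1, p.2] := by
    intro p
    by_cases h : p.1 ∈ s <;> simp [indicator, MeasurableEquiv.finTwoArrow, h]
  simp_rw [h1]
  rw [Measure.volume_eq_prod, lintegral_prod _ (by
    refine AEMeasurable.mul ?_ hd.aemeasurable
    exact ((measurable_one.indicator hs).comp measurable_fst).aemeasurable)]
  have h2 : ∀ x : ℝ, ∫⁻ y, s.indicator 1 x * dens ![x, y]
      = (s ∩ Ioo (-1) 1).indicator (fun _ => 2⁻¹) x := by
    intro x
    have hm : x ∈ Ioo (-1:ℝ) 1 ↔ x ^ 2 < 1 := by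
      rw [sq_lt_one_iff_abs_lt_one, abs_lt, mem_Ioo]
    have hdx : Measurable (fun y => dens ![x, y]) :=
      hd.comp (by fun_prop : Measurable (fun y : ℝ => (x, y)))
    rw [lintegral_const_mul _ hdx]
    by_cases hx : x ^ 2 < 1
    · rw [inner_dens x hx]
      by_cases h : x ∈ s <;> simp [indicator, h, hm, hx] 
    · rw [inner_dens' x hx]
      have : x ∉ s ∩ Ioo (-1) 1 := fun h => hx (hm.1 h.2)
      rw [indicator_of_notMem this]; simp
  simp_rw [h2]
  rw [lintegral_indicator (hs.inter measurableSet_Ioo), lintegral_const, uniformSymm,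
    Measure.smul_apply, Measure.restrict_apply_univ, Measure.restrict_congr_set Ioo_ae_eq_Icc.symm,
    Measure.restrict_apply hs]
  simp

lemma proj_meas (θ : ℝ) : Measurable (proj θ) := by unfold proj; fun_prop

lemma marg (θ : ℝ) : Measure.map (proj θ) diskLaw = uniformSymm := by
  have : proj θ = (fun x : Fin 2 → ℝ => x 0) ∘ (Matrix.toLin' (rot θ)) := by
    ext x; simp only [Function.comp, rot_zero]
  rw [this, ← Measure.map_map (measurable_pi_apply 0) (rot_meas θ), rot_map, marg0]

lemma abs_cos_int (φ : ℝ) : ∫ t in (0:ℝ)..Real.pi, |Real.cos (t - φ)| = 2 := by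
  rw [intervalIntegral.integral_comp_sub_right (fun t => |Real.cos t|)]
  have hp : Function.Periodic (fun t => |Real.cos t|) Real.pi := by
    intro t; simp [Real.cos_add_pi]
  have h := hp.intervalIntegral_add_eq (0 - φ) (-(Real.pi / 2))
  have e1 : 0 - φ + Real.pi = Real.pi - φ := by ring
  have e2 : -(Real.pi / 2) + Real.pi = Real.pi / 2 := by ring
  rw [e1, e2] at h
  rw [h, intervalIntegral.integral_congr (g := Real.cos)]
  · simp; norm_num
  · intro t ht
    rw [uIcc_of_le (by linarith [Real.pi_pos])] at ht
    exact abs_of_nonneg (Real.cos_nonneg_of_mem_Icc ht)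

lemma crofton (a b : ℝ) :
    ∫ t in (0:ℝ)..Real.pi, |Real.cos t * a + Real.sin t * b| = 2 * Real.sqrt (a ^ 2 + b ^ 2) := by
  have hr : ‖(⟨a, b⟩ : ℂ)‖ = Real.sqrt (a ^ 2 + b ^ 2) := by
    rw [Complex.norm_eq_sqrt_sq_add_sq]
  have ha := Complex.norm_mul_cos_arg (⟨a, b⟩ : ℂ)
  have hb := Complex.norm_mul_sin_arg (⟨a, b⟩ : ℂ)
  rw [hr] at ha hb
  simp only at ha hb
  have : ∀ t, |Real.cos t * a + Real.sin t * b|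
      = Real.sqrt (a ^ 2 + b ^ 2) * |Real.cos (t - Complex.arg ⟨a, b⟩)| := by
    intro t
    rw [← abs_of_nonneg (Real.sqrt_nonneg (a ^ 2 + b ^ 2)), ← abs_mul, Real.cos_sub]
    congr 1
    linear_combination (- Real.cos t) * ha - Real.sin t * hb
  simp_rw [this]
  rw [intervalIntegral.integral_const_mul, abs_cos_int]; ring

lemma abs_sub_int (u : ℝ) (hu : u ∈ Icc (-1:ℝ) 1) : ∫ v in (-1:ℝ)..1, |u - v| = u ^ 2 + 1 := by
  have hi : ∀ a b : ℝ, IntervalIntegrable (fun v => |u - v|) volume a b :=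
    fun a b => Continuous.intervalIntegrable (by fun_prop) _ _
  rw [← intervalIntegral.integral_add_adjacent_intervals (hi (-1) u) (hi u 1)]
  rw [intervalIntegral.integral_congr (a := -1) (b := u) (g := fun v => u - v)]
  · rw [intervalIntegral.integral_congr (a := u) (b := 1) (g := fun v => v - u)]
    · rw [intervalIntegral.integral_sub (by simp) (by simp),
        intervalIntegral.integral_sub (by simp) (by simp)]
      simp; ring
    · intro v hv
      rw [uIcc_of_le hu.2] at hv
      simp only
      rw [abs_of_nonpos (by linarith [hv.1])]; ring
  · intro v hv
    rw [uIcc_of_le hu.1] at hv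
    exact abs_of_nonneg (by linarith [hv.2])

lemma lint_of_cont (a b : ℝ) (hab : a ≤ b) (f : ℝ → ℝ) (hf : Continuous f) (h0 : ∀ x, 0 ≤ f x) :
    ∫⁻ x in Icc a b, ENNReal.ofReal (f x) = ENNReal.ofReal (∫ x in a..b, f x) := by
  rw [intervalIntegral.integral_of_le hab, ← integral_Icc_eq_integral_Ioc,
    ofReal_integral_eq_lintegral_ofReal]
  · exact (hf.continuousOn).integrableOn_Icc
  · exact Filter.Eventually.of_forall h0

lemma half_mul (r : ℝ) : (2:ℝ≥0∞)⁻¹ * ENNReal.ofReal r = ENNReal.ofReal (r / 2) := by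
  rw [show (2:ℝ≥0∞)⁻¹ = ENNReal.ofReal (2⁻¹) by
    rw [ENNReal.ofReal_inv_of_pos (by norm_num)]; simp, ← ENNReal.ofReal_mul (by norm_num)]
  congr 1; ring

lemma unif_int : ∫⁻ u, ∫⁻ v, ENNReal.ofReal |u - v| ∂uniformSymm ∂uniformSymm
    = ENNReal.ofReal (2 / 3) := by
  unfold uniformSymm
  rw [lintegral_smul_measure, smul_eq_mul]
  rw [setLIntegral_congr_fun (g := fun u => ENNReal.ofReal ((u ^ 2 + 1) / 2)) measurableSet_Icc]
  · rw [lint_of_cont _ _ (by norm_num) _ (by fun_prop) (fun x => by positivity), half_mul]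
    congr 1
    rw [intervalIntegral.integral_div, intervalIntegral.integral_add (by simp) (by simp)]
    simp; norm_num
  · intro u hu
    simp only
    rw [lintegral_smul_measure, smul_eq_mul,
      lint_of_cont _ _ (by norm_num) _ (by fun_prop) (fun x => abs_nonneg _), half_mul,
      abs_sub_int u hu]

lemma dist_eq (x y : Fin 2 → ℝ) : ENNReal.ofReal (dist2 x y)
    = 2⁻¹ * ∫⁻ t in Icc 0 Real.pi, ENNReal.ofReal |proj t x - proj t y| := by
  have : ∀ t, proj t x - proj t y = Real.cos t * (x 0 - y 0) + Real.sin t * (x 1 - y 1) := by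
    intro t; unfold proj; ring
  simp_rw [this]
  rw [lint_of_cont _ _ Real.pi_pos.le _ (by fun_prop) (fun _ => abs_nonneg _), crofton, half_mul]
  simp [dist2]

instance : SFinite diskLaw := by rw [diskLaw_eq]; infer_instance
instance : SFinite uniformSymm := by unfold uniformSymm; infer_instance

lemma lint_val : ∫⁻ x, ∫⁻ y, ENNReal.ofReal (dist2 x y) ∂diskLaw ∂diskLaw
    = ENNReal.ofReal (Real.pi / 3) := by
  have hm : Measurable (fun p : ((Fin 2 → ℝ) × (Fin 2 → ℝ)) × ℝ =>
      ENNReal.ofReal |proj p.2 p.1.1 - proj p.2 p.1.2|) := by unfold proj; fun_prop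
  have h1 : ∀ x : Fin 2 → ℝ, ∫⁻ y, ENNReal.ofReal (dist2 x y) ∂diskLaw
      = 2⁻¹ * ∫⁻ t in Icc 0 Real.pi, ∫⁻ y, ENNReal.ofReal |proj t x - proj t y| ∂diskLaw := by
    intro x
    simp_rw [dist_eq]
    have hmx : Measurable (fun p : (Fin 2 → ℝ) × ℝ =>
      ENNReal.ofReal |proj p.2 x - proj p.2 p.1|) := by unfold proj; fun_prop
    rw [lintegral_const_mul _ hmx.lintegral_prod_right', lintegral_lintegral_swap hmx.aemeasurable]
  simp_rw [h1]
  have hm2 : Measurable (fun p : (Fin 2 → ℝ) × ℝ =>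
      ∫⁻ y, ENNReal.ofReal |proj p.2 p.1 - proj p.2 y| ∂diskLaw) := by
    have : Measurable (fun p : ((Fin 2 → ℝ) × ℝ) × (Fin 2 → ℝ) =>
      ENNReal.ofReal |proj p.1.2 p.1.1 - proj p.1.2 p.2|) := by unfold proj; fun_prop
    exact this.lintegral_prod_right'
  rw [lintegral_const_mul _ hm2.lintegral_prod_right', lintegral_lintegral_swap hm2.aemeasurable]
  have h2 : ∀ t, ∫⁻ x, ∫⁻ y, ENNReal.ofReal |proj t x - proj t y| ∂diskLaw ∂diskLaw
      = ENNReal.ofReal (2 / 3) := by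
    intro t
    rw [← unif_int]
    have hu : Measurable (fun u : ℝ => ∫⁻ v, ENNReal.ofReal |u - v| ∂uniformSymm) := by
      have : Measurable (fun p : ℝ × ℝ => ENNReal.ofReal |p.1 - p.2|) := by fun_prop
      exact this.lintegral_prod_right'
    have h3 := lintegral_map (μ := diskLaw) hu (proj_meas t)
    rw [marg t] at h3
    rw [h3]
    congr 1
    ext x
    rw [← marg t, lintegral_map (by fun_prop) (proj_meas t)]
  simp_rw [h2]
  rw [lintegral_const, Measure.restrict_apply_univ, Real.volume_Icc,
    ← ENNReal.ofReal_mul (by norm_num), half_mul]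
  congr 1; ring

lemma dist2_meas : Measurable (fun p : (Fin 2 → ℝ) × (Fin 2 → ℝ) => dist2 p.1 p.2) := by
  unfold dist2; fun_prop

lemma S_disk : S 2 diskLaw diskLaw = Real.pi / 3 := by
  have hl : ∫⁻ p, ENNReal.ofReal (dist2 p.1 p.2) ∂(diskLaw.prod diskLaw)
      = ENNReal.ofReal (Real.pi / 3) := by
    rw [lintegral_prod _ dist2_meas.ennreal_ofReal.aemeasurable, lint_val]
  have h0 : ∀ p : (Fin 2 → ℝ) × (Fin 2 → ℝ), 0 ≤ dist2 p.1 p.2 := fun p => Real.sqrt_nonneg _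
  have hi : Integrable (fun p : (Fin 2 → ℝ) × (Fin 2 → ℝ) => dist2 p.1 p.2)
      (diskLaw.prod diskLaw) := by
    refine ⟨dist2_meas.aestronglyMeasurable, ?_⟩
    rw [hasFiniteIntegral_iff_ofReal (Filter.Eventually.of_forall h0), hl]
    exact ENNReal.ofReal_lt_top
  unfold S
  rw [← integral_prod _ hi, integral_eq_lintegral_of_nonneg_ae (Filter.Eventually.of_forall h0)
    dist2_meas.aestronglyMeasurable, hl, ENNReal.toReal_ofReal (by positivity)]

lemma S_circ : S 2 CCirc2 CCirc2 = Real.pi / 6 := by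
  have hs : Measurable (fun x : Fin 2 → ℝ => fun i => (x i + 1) / 2) := by fun_prop
  have : SFinite CCirc2 := by unfold CCirc2; infer_instance
  have hd : ∀ x y : Fin 2 → ℝ, dist2 (fun i => (x i + 1) / 2) (fun i => (y i + 1) / 2)
      = dist2 x y / 2 := by
    intro x y
    unfold dist2
    rw [show (∑ i, ((x i + 1) / 2 - (y i + 1) / 2) ^ 2) = (∑ i, (x i - y i) ^ 2) / 2 ^ 2 by
      rw [Finset.sum_div]; refine Finset.sum_congr rfl fun i _ => ?_; ring,
      Real.sqrt_div' _ (by norm_num), Real.sqrt_sq (by norm_num)]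
  have h1 : ∀ x : Fin 2 → ℝ, ∫ y, dist2 x y ∂CCirc2
      = ∫ y, dist2 x (fun i => (y i + 1) / 2) ∂diskLaw := by
    intro x
    unfold CCirc2
    rw [integral_map hs.aemeasurable]
    exact (dist2_meas.comp measurable_prodMk_left).aestronglyMeasurable
  have hsm : StronglyMeasurable (fun x : Fin 2 → ℝ => ∫ y, dist2 x y ∂CCirc2) :=
    dist2_meas.stronglyMeasurable.integral_prod_right'
  unfold S
  have h2 : ∫ x, ∫ y, dist2 x y ∂CCirc2 ∂CCirc2
      = ∫ x, ∫ y, dist2 (fun i => (x i + 1) / 2) y ∂CCirc2 ∂diskLaw := by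
    conv_lhs => rw [CCirc2]
    exact integral_map hs.aemeasurable hsm.aestronglyMeasurable
  rw [h2]
  simp_rw [h1, hd, integral_div]
  have := S_disk
  unfold S at this
  rw [this]; ring

/-- both marginals of `diskLaw` are uniform on `[-1,1]`; for independent
`X, Y ∼ diskLaw` one has `E‖X-Y‖₂ = π/3`; consequently `S(C°,C°) = π/6`, so the bound
`S(C,C) ≤ π/6` for bivariate copulas is sharp. -/
theorem stmt9 :
    (∀ i : Fin 2, Measure.map (fun x => x i) diskLaw = uniformSymm) ∧
    S 2 diskLaw diskLaw = Real.pi / 3 ∧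
    S 2 CCirc2 CCirc2 = Real.pi / 6 := by
  refine ⟨fun i => ?_, S_disk, S_circ⟩
  fin_cases i
  · exact marg0
  · have h := marg (Real.pi / 2)
    have e : proj (Real.pi / 2) = fun x => x 1 := by ext x; simp [proj]
    rw [e] at h
    exact h
end

section
/- For every copula C on [0,1]⁴, S(C,C) ≤ 64/(15π√3), where S(C,C) = ∫∫ ‖x−y‖₂ C(dx) C(dy). (This equals √(1/3)·(64/(15π)) ≈ 0.784 and improves the Jensen bound √(2/3) ≈ 0.816.) -/
open MeasureTheory Set

/-- The uniform (Lebesgue) measure on `[0,1]`. -/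
noncomputable def uniform01 : Measure ℝ := volume.restrict (Set.Icc 0 1)

/-- A copula: a probability measure on `[0,1]^d` whose one-dimensional coordinate
marginals all equal the uniform measure on `[0,1]`. -/
def IsCopula (d : ℕ) (C : Measure (Fin d → ℝ)) : Prop :=
  IsProbabilityMeasure C ∧ ∀ i : Fin d, Measure.map (fun x => x i) C = uniform01



noncomputable def rr (ρ θ : ℝ) : ℝ := Real.sqrt (1 + ρ ^ 2 - 2 * ρ * Real.cos θ)

noncomputable def AA (ρ : ℝ) : ℝ := ∫ θ in (0:ℝ)..Real.pi, rr ρ θ * Real.sin θ ^ 2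

lemma rr_arg_pos {ρ : ℝ} (h0 : 0 ≤ ρ) (h1 : ρ < 1) (θ : ℝ) :
    (1 - ρ) ^ 2 ≤ 1 + ρ ^ 2 - 2 * ρ * Real.cos θ := by
  nlinarith [Real.cos_le_one θ, mul_le_mul_of_nonneg_left (Real.cos_le_one θ) h0]

lemma rr_ge {ρ : ℝ} (h0 : 0 ≤ ρ) (h1 : ρ < 1) (θ : ℝ) : 1 - ρ ≤ rr ρ θ :=
  Real.le_sqrt_of_sq_le (rr_arg_pos h0 h1 θ)

lemma rr_pos {ρ : ℝ} (h0 : 0 ≤ ρ) (h1 : ρ < 1) (θ : ℝ) : 0 < rr ρ θ := by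
  linarith [rr_ge h0 h1 θ]

lemma rr_sq {ρ : ℝ} (h0 : 0 ≤ ρ) (h1 : ρ < 1) (θ : ℝ) :
    rr ρ θ ^ 2 = 1 + ρ ^ 2 - 2 * ρ * Real.cos θ :=
  Real.sq_sqrt (by nlinarith [rr_arg_pos h0 h1 θ])

lemma rr_cont : Continuous (fun p : ℝ × ℝ => rr p.1 p.2) := by
  unfold rr; fun_prop

lemma rr_cont' (ρ : ℝ) : Continuous (fun θ => rr ρ θ) := by
  unfold rr; fun_prop

lemma rr_hasDerivAt {ρ : ℝ} (h0 : 0 ≤ ρ) (h1 : ρ < 1) (θ : ℝ) :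
    HasDerivAt (fun ρ => rr ρ θ) ((ρ - Real.cos θ) / rr ρ θ) ρ := by
  have hp := rr_arg_pos h0 h1 θ
  have : HasDerivAt (fun ρ : ℝ => 1 + ρ ^ 2 - 2 * ρ * Real.cos θ) (2 * ρ - 2 * Real.cos θ) ρ := by
    have := (((hasDerivAt_id ρ).pow 2).const_add 1).sub
      (((hasDerivAt_id ρ).const_mul 2).mul_const (Real.cos θ))
    refine HasDerivAt.congr_deriv this ?_
    simp
  have h := this.sqrt (by nlinarith)
  refine HasDerivAt.congr_deriv h ?_
  have := rr_pos h0 h1 θ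
  unfold rr at *
  field_simp

lemma rr_hasDerivAt_theta {ρ : ℝ} (h0 : 0 ≤ ρ) (h1 : ρ < 1) (θ : ℝ) :
    HasDerivAt (fun θ => rr ρ θ) (ρ * Real.sin θ / rr ρ θ) θ := by
  have hp := rr_arg_pos h0 h1 θ
  have : HasDerivAt (fun θ : ℝ => 1 + ρ ^ 2 - 2 * ρ * Real.cos θ) (2 * ρ * Real.sin θ) θ := by
    have := ((Real.hasDerivAt_cos θ).const_mul (2 * ρ)).const_sub (1 + ρ ^ 2)
    refine HasDerivAt.congr_deriv this ?_
    simp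
  have h := this.sqrt (by nlinarith)
  refine HasDerivAt.congr_deriv h ?_
  have := rr_pos h0 h1 θ
  unfold rr at *
  field_simp

noncomputable def BB (ρ : ℝ) : ℝ :=
  ∫ θ in (0:ℝ)..Real.pi, (ρ - Real.cos θ) / rr ρ θ * Real.sin θ ^ 2

noncomputable def DD (ρ : ℝ) : ℝ :=
  ∫ θ in (0:ℝ)..Real.pi, Real.sin θ ^ 2 / rr ρ θ ^ 3 * Real.sin θ ^ 2

lemma int_B {ρ : ℝ} (h0 : 0 ≤ ρ) (h1 : ρ < 1) :
    Continuous (fun θ => (ρ - Real.cos θ) / rr ρ θ * Real.sin θ ^ 2) := by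
  have := rr_cont' ρ
  have h : ∀ θ, rr ρ θ ≠ 0 := fun θ => (rr_pos h0 h1 θ).ne'
  fun_prop (disch := assumption)

lemma int_D {ρ : ℝ} (h0 : 0 ≤ ρ) (h1 : ρ < 1) :
    Continuous (fun θ => Real.sin θ ^ 2 / rr ρ θ ^ 3 * Real.sin θ ^ 2) := by
  have := rr_cont' ρ
  have h : ∀ θ, rr ρ θ ^ 3 ≠ 0 := fun θ => (pow_pos (rr_pos h0 h1 θ) 3).ne'
  fun_prop (disch := assumption)

lemma AA_deriv {ρ : ℝ} (h0 : 0 < ρ) (h1 : ρ < 1) : HasDerivAt AA (BB ρ) ρ := by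
  have hs : Ioo 0 ((1 + ρ) / 2) ∈ nhds ρ := Ioo_mem_nhds h0 (by linarith)
  refine (intervalIntegral.hasDerivAt_integral_of_dominated_loc_of_deriv_le
    (F := fun ρ θ => rr ρ θ * Real.sin θ ^ 2)
    (F' := fun ρ θ => (ρ - Real.cos θ) / rr ρ θ * Real.sin θ ^ 2) (bound := fun _ => 2 / ((1 - ρ) / 2))
    hs ?_ ?_ ?_ ?_ ?_ ?_).2
  · refine Filter.Eventually.of_forall fun x => ?_
    have := rr_cont' x
    exact Continuous.aestronglyMeasurable (by fun_prop)
  · have := rr_cont' ρ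
    exact Continuous.intervalIntegrable (by fun_prop) _ _
  · exact (int_B h0.le h1).aestronglyMeasurable
  · refine Filter.Eventually.of_forall fun θ _ x hx => ?_
    have hx1 : x < 1 := by linarith [hx.2]
    have h2 := rr_ge hx.1.le hx1 θ
    have h3 : (1 - ρ) / 2 ≤ rr x θ := by linarith [hx.2]
    rw [norm_mul, norm_div, Real.norm_eq_abs, Real.norm_eq_abs, Real.norm_eq_abs,
      abs_of_pos (rr_pos hx.1.le hx1 θ), abs_of_nonneg (sq_nonneg (Real.sin θ))]
    have h4 : |x - Real.cos θ| ≤ 2 := by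
      rw [abs_le]; constructor <;> linarith [Real.cos_le_one θ, Real.neg_one_le_cos θ, hx.1]
    calc _ ≤ |x - Real.cos θ| / rr x θ * 1 := by
          gcongr
          exact div_nonneg (abs_nonneg _) (rr_pos hx.1.le hx1 θ).le
          exact Real.sin_sq_le_one θ
      _ ≤ _ := by
          rw [mul_one]
          exact div_le_div₀ (by norm_num) h4 (by linarith) h3
  · simp
  · refine Filter.Eventually.of_forall fun θ _ x hx => ?_
    exact (rr_hasDerivAt hx.1.le (by linarith [hx.2]) θ).mul_const _

lemma BB_deriv {ρ : ℝ} (h0 : 0 < ρ) (h1 : ρ < 1) : HasDerivAt BB (DD ρ) ρ := by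
  have hs : Ioo 0 ((1 + ρ) / 2) ∈ nhds ρ := Ioo_mem_nhds h0 (by linarith)
  refine (intervalIntegral.hasDerivAt_integral_of_dominated_loc_of_deriv_le
    (F := fun ρ θ => (ρ - Real.cos θ) / rr ρ θ * Real.sin θ ^ 2)
    (F' := fun ρ θ => Real.sin θ ^ 2 / rr ρ θ ^ 3 * Real.sin θ ^ 2)
    (bound := fun _ => 1 / ((1 - ρ) / 2) ^ 3)
    hs ?_ ?_ ?_ ?_ ?_ ?_).2
  · filter_upwards [hs] with x hx
    exact (int_B hx.1.le (by linarith [hx.2])).aestronglyMeasurable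
  · exact (int_B h0.le h1).intervalIntegrable _ _
  · exact (int_D h0.le h1).aestronglyMeasurable
  · refine Filter.Eventually.of_forall fun θ _ x hx => ?_
    have hx1 : x < 1 := by linarith [hx.2]
    have h2 := rr_ge hx.1.le hx1 θ
    have h3 : (1 - ρ) / 2 ≤ rr x θ := by linarith [hx.2]
    have hp := rr_pos hx.1.le hx1 θ
    rw [Real.norm_eq_abs, abs_of_nonneg (by positivity)]
    have h5 : 0 < (1 - ρ) / 2 := by linarith
    calc _ ≤ Real.sin θ ^ 2 / rr x θ ^ 3 * 1 := by
          gcongr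
          exact Real.sin_sq_le_one θ
      _ ≤ _ := by
          rw [mul_one]
          exact div_le_div₀ (by norm_num) (Real.sin_sq_le_one θ) (by positivity) (by gcongr)
  · simp
  · refine Filter.Eventually.of_forall fun θ _ x hx => ?_
    have hx1 : x < 1 := by linarith [hx.2]
    have hp := rr_pos hx.1.le hx1 θ
    have h := ((hasDerivAt_id x).sub_const (Real.cos θ)).div (rr_hasDerivAt hx.1.le hx1 θ) hp.ne'
    have h6 := h.mul_const (Real.sin θ ^ 2)
    refine HasDerivAt.congr_deriv h6 ?_
    have hsq := rr_sq hx.1.le hx1 θ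
    have hsin := Real.sin_sq θ
    congr 1
    simp only [id]
    field_simp
    rw [hsq, hsin]; ring

lemma ode {ρ : ℝ} (h0 : 0 < ρ) (h1 : ρ < 1) :
    (1 - ρ ^ 2) * ρ * DD ρ + (3 + 3 * ρ ^ 2) * BB ρ - 3 * ρ * AA ρ = 0 := by
  have hA : IntervalIntegrable (fun θ => rr ρ θ * Real.sin θ ^ 2) volume 0 Real.pi := by
    have := rr_cont' ρ
    exact Continuous.intervalIntegrable (by fun_prop) _ _
  have hB := (int_B h0.le h1).intervalIntegrable (μ := volume) 0 Real.pi
  have hD := (int_D h0.le h1).intervalIntegrable (μ := volume) 0 Real.pi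
  unfold AA BB DD
  rw [← intervalIntegral.integral_const_mul, ← intervalIntegral.integral_const_mul,
    ← intervalIntegral.integral_const_mul,
    ← intervalIntegral.integral_add (hD.const_mul _) (hB.const_mul _),
    ← intervalIntegral.integral_sub ((hD.const_mul _).add (hB.const_mul _)) (hA.const_mul _)]
  have key : ∀ θ ∈ uIcc 0 Real.pi, HasDerivAt (fun θ => -(1 - ρ ^ 2) * (Real.sin θ ^ 3 / rr ρ θ))
    ((1 - ρ ^ 2) * ρ * (Real.sin θ ^ 2 / rr ρ θ ^ 3 * Real.sin θ ^ 2) +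
     (3 + 3 * ρ ^ 2) * ((ρ - Real.cos θ) / rr ρ θ * Real.sin θ ^ 2) -
      3 * ρ * (rr ρ θ * Real.sin θ ^ 2)) θ := by
    intro θ _
    have hp := rr_pos h0.le h1 θ
    have h := ((((Real.hasDerivAt_sin θ).pow 3).div (rr_hasDerivAt_theta h0.le h1 θ) hp.ne').const_mul
      (-(1 - ρ ^ 2)))
    refine HasDerivAt.congr_deriv h ?_
    have hsq := rr_sq h0.le h1 θ
    have h4 : rr ρ θ ^ 4 = (1 + ρ ^ 2 - 2 * ρ * Real.cos θ) ^ 2 := by rw [← hsq]; ring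
    simp only [Nat.cast_ofNat, Nat.add_one_sub_one, Pi.pow_apply]
    field_simp
    ring_nf
    rw [h4, hsq]; ring
  rw [intervalIntegral.integral_eq_sub_of_hasDerivAt key]
  · simp
  · exact (((hD.const_mul _).add (hB.const_mul _)).sub (hA.const_mul _))

lemma AA_cont : Continuous AA := by
  unfold AA
  have := rr_cont
  apply intervalIntegral.continuous_parametric_intervalIntegral_of_continuous' (f := fun ρ θ => rr ρ θ * Real.sin θ ^ 2)
  unfold Function.uncurry
  fun_prop

lemma AA_one : AA 1 = 32 / 15 := by
  unfold AA
  have h : ∀ θ ∈ uIcc 0 Real.pi, HasDerivAt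
     (fun θ => 16 * (-(Real.cos (θ/2)) ^ 3 / 3 + (Real.cos (θ/2)) ^ 5 / 5)) (rr 1 θ * Real.sin θ ^ 2) θ := by
    intro θ hθ
    rw [uIcc_of_le Real.pi_pos.le] at hθ
    have h1 : HasDerivAt (fun θ : ℝ => Real.cos (θ/2)) (-Real.sin (θ/2) * (1/2)) θ :=
      ((hasDerivAt_id θ).div_const 2).cos
    have h2 := ((((h1.pow 3).neg).div_const 3).add ((h1.pow 5).div_const 5)).const_mul 16
    refine HasDerivAt.congr_deriv h2 ?_
    have hs : 0 ≤ Real.sin (θ/2) := Real.sin_nonneg_of_nonneg_of_le_pi (by linarith [hθ.1]) (by linarith [hθ.2, Real.pi_pos])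
    have e1 : Real.cos θ = 1 - 2 * Real.sin (θ/2)^2 := by
      have := Real.cos_two_mul (θ/2); have h4 := Real.sin_sq (θ/2)
      rw [show 2 * (θ/2) = θ by ring] at this; linarith
    have e2 : Real.sin θ = 2 * Real.sin (θ/2) * Real.cos (θ/2) := by
      rw [← Real.sin_two_mul]; ring_nf
    have e3 : rr 1 θ = 2 * Real.sin (θ/2) := by
      unfold rr
      rw [e1, show (1:ℝ) + 1 ^ 2 - 2 * 1 * (1 - 2 * Real.sin (θ/2)^2) = (2 * Real.sin (θ/2))^2 by ring,
        Real.sqrt_sq (by linarith)]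
    rw [e3, e2]
    have h4 : Real.sin (θ/2) ^ 3 = Real.sin (θ/2) * (1 - Real.cos (θ/2) ^ 2) := by
      rw [← Real.sin_sq]; ring
    simp only [Nat.cast_ofNat, Nat.add_one_sub_one]
    ring_nf at h4 ⊢
    rw [h4]; ring
  rw [intervalIntegral.integral_eq_sub_of_hasDerivAt h]
  · simp; norm_num
  · have := rr_cont' 1
    exact Continuous.intervalIntegrable (by fun_prop) _ _

lemma AA_zero : AA 0 = Real.pi / 2 := by
  unfold AA rr
  simp [integral_sin_sq]

lemma AA_le_of_lt_one {ρ : ℝ} (h0 : 0 ≤ ρ) (h1 : ρ ≤ 1) : AA ρ ≤ 8 / 15 * (3 + ρ ^ 2) := by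
  set h : ℝ → ℝ := fun x => 8 / 15 * (3 + x ^ 2) - AA x with hh
  have hc : ContinuousOn h (Icc 0 1) := by
    have := AA_cont
    exact Continuous.continuousOn (by fun_prop)
  obtain ⟨m, hm, hmin⟩ := isCompact_Icc.exists_isMinOn (nonempty_Icc.2 zero_le_one) hc
  suffices 0 ≤ h m by
    have h2 : h m ≤ h ρ := hmin ⟨h0, h1⟩
    simp only [hh] at this h2
    linarith
  by_contra! hneg
  have hm0 : m ≠ 0 := by
    rintro rfl
    simp only [hh, AA_zero] at hneg
    linarith [Real.pi_lt_d2]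
  have hm1 : m ≠ 1 := by
    rintro rfl
    simp only [hh, AA_one] at hneg
    norm_num at hneg
  have m0 : 0 < m := lt_of_le_of_ne hm.1 (Ne.symm hm0)
  have m1 : m < 1 := lt_of_le_of_ne hm.2 hm1
  have hd : ∀ x ∈ Ioo (0:ℝ) 1, HasDerivAt h (16 / 15 * x - BB x) x := by
    intro x hx
    have := ((((hasDerivAt_id x).pow 2).const_add 3).const_mul (8/15)).sub (AA_deriv hx.1 hx.2)
    refine HasDerivAt.congr_deriv this ?_
    simp; ring
  have hloc : IsLocalMin h m := hmin.isLocalMin (Icc_mem_nhds m0 m1)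
  have hk0 : 16 / 15 * m - BB m = 0 := hloc.hasDerivAt_eq_zero (hd m ⟨m0, m1⟩)
  have hk : HasDerivAt (fun x => 16 / 15 * x - BB x) (16 / 15 - DD m) m := by
    have := ((hasDerivAt_id m).const_mul (16/15)).sub (BB_deriv m0 m1)
    refine HasDerivAt.congr_deriv this ?_
    simp
  have hkneg : 16 / 15 - DD m < 0 := by
    have ho := ode m0 m1
    have hB : BB m = 16 / 15 * m := by linarith
    simp only [hh] at hneg
    rw [hB] at ho
    by_contra! hcon
    have h5 : 0 < (1 - m ^ 2) * m := by
      have : 0 < 1 - m ^ 2 := by nlinarith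
      positivity
    nlinarith [mul_le_mul_of_nonneg_left hcon h5.le, mul_pos m0 (neg_pos.2 hneg), h5]
  have hev : ∀ᶠ x in nhdsWithin m (Ioi m), 16 / 15 * x - BB x < 0 := by
    have := hk.tendsto_slope
    have h6 : ∀ᶠ x in nhdsWithin m {m}ᶜ, slope (fun x => 16 / 15 * x - BB x) m x < 0 :=
      this.eventually (gt_mem_nhds hkneg)
    have h7 := h6.filter_mono (nhdsWithin_mono m (fun x (hx : m < x) => (ne_of_gt hx : x ≠ m)))
    filter_upwards [h7, self_mem_nhdsWithin] with x hx hxm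
    rw [slope_def_field, hk0, sub_zero] at hx
    have hxm' : 0 < x - m := sub_pos.2 hxm
    by_contra! hge
    exact absurd hx (not_lt.2 (div_nonneg hge hxm'.le))
  obtain ⟨b, hb, hb2⟩ := (mem_nhdsGT_iff_exists_Ioo_subset' m1).1 hev
  set c := min b ((m + 1) / 2) with hcdef
  have hmc : m < c := lt_min hb (by linarith)
  have hc1 : c < 1 := lt_of_le_of_lt (min_le_right _ _) (by linarith)
  obtain ⟨z, hz, hz2⟩ := exists_hasDerivAt_eq_slope h _ hmc
    (hc.mono (Icc_subset_Icc m0.le hc1.le))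
    (fun x hx => hd x ⟨m0.trans hx.1, hx.2.trans hc1⟩)
  have h8 : 16 / 15 * z - BB z < 0 := hb2 ⟨hz.1, hz.2.trans_le (min_le_left _ _)⟩
  have h9 : h m ≤ h c := hmin ⟨(m0.trans hmc).le, hc1.le⟩
  rw [hz2] at h8
  exact absurd h8 (not_lt.2 (div_nonneg (by linarith) (by linarith)))

lemma AA_le {ρ : ℝ} (h0 : 0 ≤ ρ) : AA ρ ≤ 8 / 15 * (3 + ρ ^ 2) := by
  rcases le_or_gt ρ 1 with h | h
  · exact AA_le_of_lt_one h0 h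
  have hp : 0 < ρ := by linarith
  have e : AA ρ = ρ * AA ρ⁻¹ := by
    unfold AA
    rw [← intervalIntegral.integral_const_mul]
    congr 1
    ext θ
    rw [← mul_assoc]
    congr 1
    unfold rr
    nth_rewrite 3 [← Real.sqrt_sq h0]
    rw [← Real.sqrt_mul (sq_nonneg ρ)]
    congr 1
    field_simp
    ring
  have h2 := AA_le_of_lt_one (ρ := ρ⁻¹) (by positivity) (inv_le_one_of_one_le₀ h.le)
  rw [e]
  calc _ ≤ ρ * (8 / 15 * (3 + ρ⁻¹ ^ 2)) := by gcongr
    _ = 8 / 15 * (3 * ρ + ρ⁻¹) := by field_simp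
    _ ≤ _ := by
      have : 0 ≤ (ρ - 1) ^ 3 / ρ := by
        have : 0 ≤ ρ - 1 := by linarith
        positivity
      have h3 : (ρ - 1) ^ 3 / ρ = 3 + ρ ^ 2 - (3 * ρ + ρ⁻¹) := by field_simp; ring
      linarith


abbrev E3 := EuclideanSpace ℝ (Fin 3)
abbrev E4 := WithLp 2 (ℝ × E3)

noncomputable def nrm (y : E4) : E4 := ‖y‖⁻¹ • y

noncomputable def gg (f : ℝ → ℝ) (q : ℝ × ℝ) : ℝ :=
  if q.1 ^ 2 + q.2 ^ 2 < 1 then f (q.1 / Real.sqrt (q.1 ^ 2 + q.2 ^ 2)) else 0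

lemma gg_meas {f : ℝ → ℝ} (hf : Continuous f) : Measurable (gg f) := by
  unfold gg
  refine Measurable.ite (measurableSet_lt (by fun_prop) (by fun_prop)) ?_ measurable_const
  exact hf.measurable.comp (by fun_prop)

lemma div_sqrt_mem (a r : ℝ) : a / Real.sqrt (a ^ 2 + r ^ 2) ∈ Icc (-1:ℝ) 1 := by
  rw [mem_Icc, ← abs_le, abs_div, abs_of_nonneg (Real.sqrt_nonneg _)]
  apply div_le_one_of_le₀ _ (Real.sqrt_nonneg _)
  apply Real.abs_le_sqrt
  nlinarith [sq_nonneg r]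

lemma gg_bound {f : ℝ → ℝ} (hf : Continuous f) : ∃ M, 0 ≤ M ∧ ∀ q, ‖gg f q‖ ≤ M := by
  obtain ⟨M, hM⟩ := (isCompact_Icc (a := (-1:ℝ)) (b := 1)).exists_bound_of_continuousOn hf.continuousOn
  refine ⟨max M 0, le_max_right _ _, fun q => ?_⟩
  unfold gg
  split_ifs
  · exact (hM _ (div_sqrt_mem _ _)).trans (le_max_left _ _)
  · simp

lemma gg_zero {f : ℝ → ℝ} {q : ℝ × ℝ} (h : q ∉ Ioo (-1:ℝ) 1 ×ˢ Ioo (-1:ℝ) 1) : gg f q = 0 := by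
  unfold gg
  rw [if_neg]
  contrapose! h
  simp only [mem_prod, mem_Ioo, ← abs_lt]
  constructor <;> rw [← sq_lt_one_iff_abs_lt_one] <;> nlinarith [sq_nonneg q.1, sq_nonneg q.2]

lemma half_plane {f : ℝ → ℝ} :
    ∫ q in univ ×ˢ Ioi (0:ℝ), q.2 ^ 2 * gg f q =
      1 / 4 * ∫ θ in (0:ℝ)..Real.pi, f (Real.cos θ) * Real.sin θ ^ 2 := by
  rw [← integral_indicator (MeasurableSet.univ.prod measurableSet_Ioi),
    ← integral_comp_polarCoord_symm]
  have h1 : ∀ p ∈ polarCoord.target, (p.1 • (univ ×ˢ Ioi (0:ℝ)).indicator (fun q : ℝ × ℝ => q.2 ^ 2 * gg f q)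
      (polarCoord.symm p)) = (Iio (1:ℝ)).indicator (fun R => R ^ 3) p.1 *
        (Ioi (0:ℝ)).indicator (fun θ => f (Real.cos θ) * Real.sin θ ^ 2) p.2 := by
    rintro ⟨R, θ⟩ hp
    simp only [polarCoord_target, mem_prod, mem_Ioi, mem_Ioo] at hp
    obtain ⟨hR, hθ1, hθ2⟩ := hp
    rw [polarCoord_symm_apply]
    have hsum : (R * Real.cos θ) ^ 2 + (R * Real.sin θ) ^ 2 = R ^ 2 := by
      nlinarith [Real.sin_sq_add_cos_sq θ]
    rcases le_or_gt θ 0 with h | h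
    · have : Real.sin θ ≤ 0 := Real.sin_nonpos_of_nonpos_of_neg_pi_le h hθ1.le
      rw [indicator_of_notMem, indicator_of_notMem (s := Ioi (0:ℝ)) (by simpa using h)]
      · simp
      · simp only [mem_prod, mem_univ, mem_Ioi, true_and, not_lt]
        exact mul_nonpos_of_nonneg_of_nonpos hR.le this
    · have : 0 < Real.sin θ := Real.sin_pos_of_pos_of_lt_pi h hθ2
      rw [indicator_of_mem, indicator_of_mem (s := Ioi (0:ℝ)) (by simpa using h)]
      · unfold gg
        simp only [hsum, Real.sqrt_sq hR.le]
        by_cases hR1 : R < 1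
        · rw [if_pos (by nlinarith), indicator_of_mem (s := Iio (1:ℝ)) (by simpa using hR1),
            mul_div_cancel_left₀ _ hR.ne', smul_eq_mul]
          ring
        · rw [if_neg (by nlinarith), indicator_of_notMem (s := Iio (1:ℝ)) (by simpa using hR1)]
          simp
      · simp only [mem_prod, mem_univ, mem_Ioi, true_and]
        positivity
  rw [setIntegral_congr_fun polarCoord.open_target.measurableSet h1, polarCoord_target,
    Measure.volume_eq_prod,
    setIntegral_prod_mul (fun R => (Iio (1:ℝ)).indicator (fun R => R ^ 3) R)
      (fun θ => (Ioi (0:ℝ)).indicator (fun θ => f (Real.cos θ) * Real.sin θ ^ 2) θ),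
    setIntegral_indicator measurableSet_Iio, setIntegral_indicator measurableSet_Ioi]
  congr 1
  · rw [Ioi_inter_Iio, ← integral_Ioc_eq_integral_Ioo, ← intervalIntegral.integral_of_le zero_le_one]
    simp; norm_num
  · rw [intervalIntegral.integral_of_le Real.pi_pos.le, integral_Ioc_eq_integral_Ioo]
    congr 2
    ext x
    simp only [mem_inter_iff, mem_Ioo, mem_Ioi]
    have := Real.pi_pos
    constructor
    · rintro ⟨⟨_, h⟩, h'⟩; exact ⟨h', h⟩
    · rintro ⟨h, h'⟩; exact ⟨⟨by linarith, h'⟩, h⟩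

noncomputable def KK : ℝ := 3 * (volume : Measure E3).real (Metric.ball 0 1) * (1 / 4)

lemma ball_base {f : ℝ → ℝ} (hf : Continuous f) :
    ∫ y in Metric.ball (0:E4) 1, f (y.fst / ‖y‖) =
      KK * ∫ θ in (0:ℝ)..Real.pi, f (Real.cos θ) * Real.sin θ ^ 2 := by
  obtain ⟨M, hM0, hM⟩ := gg_bound hf
  have hgm := gg_meas hf
  have hn : ∀ p : ℝ × E3, ‖(WithLp.toLp 2 p : E4)‖ = Real.sqrt (p.1 ^ 2 + ‖p.2‖ ^ 2) := by
    intro p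
    rw [WithLp.prod_norm_eq_of_L2]
    simp
  rw [← integral_indicator Metric.isOpen_ball.measurableSet,
    ← (WithLp.volume_preserving_toLp (U := ℝ) (V := E3)).integral_comp
      (MeasurableEquiv.toLp 2 (ℝ × E3)).measurableEmbedding]
  have h1 : ∀ p : ℝ × E3, (Metric.ball (0:E4) 1).indicator (fun y : E4 => f (y.fst / ‖y‖)) (WithLp.toLp 2 p)
      = gg f (p.1, ‖p.2‖) := by
    intro p
    classical
    unfold gg
    rw [indicator_apply]
    simp only [mem_ball_zero_iff, hn, Real.sqrt_lt' one_pos, one_pow]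
    rfl
  simp_rw [h1]
  have hint : Integrable (fun p : ℝ × E3 => gg f (p.1, ‖p.2‖)) (volume.prod volume) := by
    have : Integrable (indicator (Ioo (-1:ℝ) 1 ×ˢ Metric.ball (0:E3) 1) (fun _ => M)) (volume.prod volume) := by
      rw [integrable_indicator_iff (measurableSet_Ioo.prod Metric.isOpen_ball.measurableSet)]
      refine integrableOn_const ?_
      rw [Measure.prod_prod]
      exact ENNReal.mul_ne_top (by simp) measure_ball_lt_top.ne
    refine this.mono' ?_ (Filter.Eventually.of_forall fun p => ?_)
    · exact (hgm.comp (by fun_prop)).aestronglyMeasurable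
    · by_cases hp : p ∈ Ioo (-1:ℝ) 1 ×ˢ Metric.ball (0:E3) 1
      · rw [indicator_of_mem hp]; exact hM _
      · rw [indicator_of_notMem hp, gg_zero, norm_zero]
        contrapose! hp
        refine ⟨hp.1, ?_⟩
        rw [mem_ball_zero_iff]; exact hp.2.2
  rw [Measure.volume_eq_prod, integral_prod _ hint]
  have h2 : ∀ a : ℝ, ∫ w : E3, gg f (a, ‖w‖) =
      (3 * (volume : Measure E3).real (Metric.ball 0 1)) * ∫ r in Ioi (0:ℝ), r ^ 2 * gg f (a, r) := by
    intro a
    rw [integral_fun_norm_addHaar volume (fun r => gg f (a, r))]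
    simp [mul_assoc]
  simp only [h2]
  rw [integral_const_mul, KK, mul_assoc (3 * _), ← half_plane, Measure.volume_eq_prod, setIntegral_prod]
  · simp
  · have : Integrable (indicator (Ioo (-1:ℝ) 1 ×ˢ Ioo (-1:ℝ) 1) (fun _ => M)) (volume.prod volume) := by
      rw [integrable_indicator_iff (measurableSet_Ioo.prod measurableSet_Ioo)]
      refine integrableOn_const ?_
      rw [Measure.prod_prod]
      exact ENNReal.mul_ne_top (by simp) (by simp)
    refine Integrable.integrableOn (this.mono' ?_ (Filter.Eventually.of_forall fun p => ?_))
    · exact Measurable.aestronglyMeasurable (by fun_prop)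
    · by_cases hp : p ∈ Ioo (-1:ℝ) 1 ×ˢ Ioo (-1:ℝ) 1
      · rw [indicator_of_mem hp, norm_mul]
        have : ‖p.2 ^ 2‖ ≤ 1 := by
          rw [norm_pow, Real.norm_eq_abs]
          exact pow_le_one₀ (abs_nonneg _) (abs_le.2 ⟨hp.2.1.le, hp.2.2.le⟩)
        calc _ ≤ 1 * M := mul_le_mul this (hM _) (norm_nonneg _) zero_le_one
          _ = M := one_mul M
      · rw [indicator_of_notMem hp, gg_zero hp, mul_zero, norm_zero]

lemma nrm_meas : Measurable nrm := by
  unfold nrm; fun_prop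

lemma ball_rot {f : ℝ → ℝ} (hf : Continuous f) (x : E4) :
    ∫ y in Metric.ball (0:E4) 1, f (inner ℝ (nrm y) x) =
      KK * ∫ θ in (0:ℝ)..Real.pi, f (‖x‖ * Real.cos θ) * Real.sin θ ^ 2 := by
  have hf' : Continuous (fun s => f (‖x‖ * s)) := by fun_prop
  rw [← ball_base hf']
  set x' : E4 := WithLp.toLp 2 (‖x‖, 0) with hx'
  have hnx : ‖x'‖ = ‖x‖ := by
    rw [WithLp.prod_norm_eq_of_L2]; simp [x']
  set L := Submodule.reflection (ℝ ∙ (x' - x))ᗮ with hL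
  have hLx : L x' = x := Submodule.reflection_sub hnx
  have hmp := L.measurePreserving
  have hpre : L ⁻¹' (Metric.ball 0 1) = Metric.ball 0 1 := by
    ext y; simp
  have := hmp.setIntegral_preimage_emb L.toHomeomorph.measurableEmbedding
    (fun y => f (inner ℝ (nrm y) x)) (Metric.ball 0 1)
  rw [← this, hpre]
  congr 1
  ext y
  have h1 : nrm (L y) = L (nrm y) := by
    unfold nrm; simp
  have h2 : inner ℝ (nrm (L y)) x = inner ℝ (nrm y) x' := by
    rw [h1, ← hLx, L.inner_map_map]
  rw [h2]
  congr 1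
  unfold nrm
  simp [x', WithLp.prod_inner_apply]
  left; ring

noncomputable def sph : Measure E4 :=
  (volume (Metric.ball (0:E4) 1))⁻¹ • (volume.restrict (Metric.ball (0:E4) 1)).map nrm

instance : IsProbabilityMeasure sph := by
  constructor
  unfold sph
  rw [Measure.smul_apply, Measure.map_apply nrm_meas MeasurableSet.univ]
  simp only [preimage_univ, Measure.restrict_apply_univ, smul_eq_mul]
  exact ENNReal.inv_mul_cancel (Metric.measure_ball_pos _ _ one_pos).ne' measure_ball_lt_top.ne

lemma sph_norm : ∀ᵐ y ∂sph, ‖y‖ = 1 := by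
  unfold sph
  apply Measure.ae_smul_measure
  rw [ae_map_iff nrm_meas.aemeasurable (measurableSet_eq_fun (by fun_prop) (by fun_prop))]
  apply ae_restrict_of_ae
  have : ∀ᵐ y : E4, y ≠ 0 := by simp [ae_iff]
  filter_upwards [this] with y hy
  unfold nrm
  rw [norm_smul, norm_inv, norm_norm, inv_mul_cancel₀ (norm_ne_zero_iff.2 hy)]

lemma sph_int {f : ℝ → ℝ} (hf : Continuous f) (x : E4) :
    ∫ y, f (inner ℝ y x) ∂sph =
      2 / Real.pi * ∫ θ in (0:ℝ)..Real.pi, f (‖x‖ * Real.cos θ) * Real.sin θ ^ 2 := by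
  have key : ∀ {f : ℝ → ℝ} (_ : Continuous f), ∫ y, f (inner ℝ y x) ∂sph =
      ((volume (Metric.ball (0:E4) 1)).toReal⁻¹ * KK) *
      ∫ θ in (0:ℝ)..Real.pi, f (‖x‖ * Real.cos θ) * Real.sin θ ^ 2 := by
    intro f hf
    unfold sph
    rw [integral_smul_measure, integral_map nrm_meas.aemeasurable, ball_rot hf]
    · simp [mul_assoc]
    · exact (hf.comp (by fun_prop)).aestronglyMeasurable
  have h1 := key (f := fun _ => 1) continuous_const
  simp [integral_sin_sq] at h1
  rw [key hf]
  congr 1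
  field_simp at h1 ⊢
  linarith


section
variable {Ω X : Type*} [MeasurableSpace Ω] [MeasurableSpace X]

lemma bdd_int {Y : Type*} [MeasurableSpace Y] {μ : Measure Y} [IsFiniteMeasure μ] {h : Y → ℝ}
    (hm : StronglyMeasurable h) {M : ℝ} (hb : ∀ y, |h y| ≤ M) : Integrable h μ :=
  Integrable.of_bound hm.aestronglyMeasurable M (Filter.Eventually.of_forall hb)

lemma abs_int_le {Y : Type*} [MeasurableSpace Y] {μ : Measure Y} [IsProbabilityMeasure μ] {h : Y → ℝ}
    {M : ℝ} (hb : ∀ y, |h y| ≤ M) : |∫ y, h y ∂μ| ≤ M := by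
  have := norm_integral_le_of_norm_le_const (μ := μ) (f := h) (C := M) (Filter.Eventually.of_forall hb)
  simpa using this

lemma sq_form (ν : Measure Ω) [IsFiniteMeasure ν] (P Q : Measure X) [IsProbabilityMeasure P]
    [IsProbabilityMeasure Q] {f : Ω → X → ℝ} (hf : Measurable (Function.uncurry f))
    (hb : ∀ ω x, |f ω x| ≤ 1) :
    ∫ x, ∫ y, ∫ ω, (f ω x - f ω y) ^ 2 ∂ν ∂Q ∂P =
      ∫ ω, ((∫ x, f ω x ^ 2 ∂P) + (∫ x, f ω x ^ 2 ∂Q) - 2 * ((∫ x, f ω x ∂P) * ∫ x, f ω x ∂Q)) ∂ν := by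
  have hfm : ∀ ω, Measurable (f ω) := fun ω => hf.comp (by fun_prop : Measurable fun x : X => (ω, x))
  have hb2 : ∀ ω x y, |(f ω x - f ω y) ^ 2| ≤ 4 := by
    intro ω x y
    have h1 := abs_le.1 (hb ω x)
    have h2 := abs_le.1 (hb ω y)
    rw [abs_of_nonneg (sq_nonneg _)]
    nlinarith
  have h1 : ∀ x, ∫ y, ∫ ω, (f ω x - f ω y) ^ 2 ∂ν ∂Q = ∫ ω, ∫ y, (f ω x - f ω y) ^ 2 ∂Q ∂ν := by
    intro x
    apply integral_integral_swap
    refine bdd_int (M := 4) ?_ (fun p => hb2 _ _ _)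
    apply Measurable.stronglyMeasurable
    have a1 : Measurable (fun p : X × Ω => f p.2 x) := hf.comp (by fun_prop : Measurable fun p : X × Ω => (p.2, x))
    have a2 : Measurable (fun p : X × Ω => f p.2 p.1) := hf.comp (by fun_prop : Measurable fun p : X × Ω => (p.2, p.1))
    exact (a1.sub a2).pow_const 2
  simp_rw [h1]
  rw [integral_integral_swap]
  · congr 1
    ext ω
    have i1 : ∀ (W : Measure X) [IsProbabilityMeasure W], Integrable (f ω) W := fun W _ =>
      bdd_int (hfm ω).stronglyMeasurable (hb ω)
    have i2 : ∀ (W : Measure X) [IsProbabilityMeasure W], Integrable (fun x => f ω x ^ 2) W := fun W _ =>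
      bdd_int (M := 1) ((hfm ω).pow_const 2).stronglyMeasurable (fun x => by
        rw [abs_pow]; exact pow_le_one₀ (abs_nonneg _) (hb ω x))
    have h2 : ∀ x, ∫ y, (f ω x - f ω y) ^ 2 ∂Q = f ω x ^ 2 + (∫ y, f ω y ^ 2 ∂Q) - 2 * (∫ y, f ω y ∂Q) * f ω x := by
      intro x
      have : ∀ y, (f ω x - f ω y) ^ 2 = (f ω x ^ 2 + f ω y ^ 2) - (2 * f ω x) * f ω y := by
        intro y; ring
      simp_rw [this]
      have e1 : Integrable (fun y => f ω x ^ 2 + f ω y ^ 2) Q := (integrable_const _).add (i2 Q)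
      rw [integral_sub e1 ((i1 Q).const_mul _),
        integral_add (integrable_const _) (i2 Q), integral_const_mul]
      simp; ring
    simp_rw [h2]
    have e2 : Integrable (fun x => f ω x ^ 2 + ∫ y, f ω y ^ 2 ∂Q) P := (i2 P).add (integrable_const _)
    rw [integral_sub e2 ((i1 P).const_mul _),
        integral_add (i2 P) (integrable_const _), integral_const_mul]
    simp; ring
  · refine bdd_int (M := 4) ?_ (fun p => abs_int_le (fun y => hb2 _ _ _))
    have : StronglyMeasurable (fun q : (X × Ω) × X => (f q.1.2 q.1.1 - f q.1.2 q.2) ^ 2) := by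
      apply Measurable.stronglyMeasurable
      have a1 : Measurable (fun q : (X × Ω) × X => f q.1.2 q.1.1) :=
        hf.comp (by fun_prop : Measurable fun q : (X × Ω) × X => (q.1.2, q.1.1))
      have a2 : Measurable (fun q : (X × Ω) × X => f q.1.2 q.2) :=
        hf.comp (by fun_prop : Measurable fun q : (X × Ω) × X => (q.1.2, q.2))
      exact (a1.sub a2).pow_const 2
    exact this.integral_prod_right'

lemma energy (ν : Measure Ω) [IsFiniteMeasure ν] (P Q : Measure X) [IsProbabilityMeasure P]
    [IsProbabilityMeasure Q] {f : Ω → X → ℝ} (hf : Measurable (Function.uncurry f))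
    (hb : ∀ ω x, |f ω x| ≤ 1) :
    (∫ x, ∫ y, ∫ ω, (f ω x - f ω y) ^ 2 ∂ν ∂P ∂P) + (∫ x, ∫ y, ∫ ω, (f ω x - f ω y) ^ 2 ∂ν ∂Q ∂Q)
      ≤ 2 * ∫ x, ∫ y, ∫ ω, (f ω x - f ω y) ^ 2 ∂ν ∂Q ∂P := by
  rw [sq_form ν P P hf hb, sq_form ν Q Q hf hb, sq_form ν P Q hf hb]
  have i1 : ∀ (W : Measure X) [IsProbabilityMeasure W], StronglyMeasurable (fun ω => ∫ x, f ω x ∂W) :=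
    fun W _ => hf.stronglyMeasurable.integral_prod_right'
  have i2 : ∀ (W : Measure X) [IsProbabilityMeasure W], StronglyMeasurable (fun ω => ∫ x, f ω x ^ 2 ∂W) :=
    fun W _ => (hf.pow_const 2).stronglyMeasurable.integral_prod_right'
  have b1 : ∀ (W : Measure X) [IsProbabilityMeasure W] ω, |∫ x, f ω x ∂W| ≤ 1 :=
    fun W _ ω => abs_int_le (hb ω)
  have j2 : ∀ (W : Measure X) [IsProbabilityMeasure W], Integrable (fun ω => ∫ x, f ω x ^ 2 ∂W) ν :=
    fun W _ => bdd_int (M := 1) (i2 W) (fun ω => abs_int_le fun x => by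
        rw [abs_pow]; exact pow_le_one₀ (abs_nonneg _) (hb ω x))
  have j1 : ∀ (W V : Measure X) [IsProbabilityMeasure W] [IsProbabilityMeasure V],
      Integrable (fun ω => 2 * ((∫ x, f ω x ∂W) * ∫ x, f ω x ∂V)) ν := fun W V _ _ =>
    (bdd_int (M := 1) ((i1 W).mul (i1 V)) (fun ω => by
      rw [Pi.mul_apply, abs_mul]; exact mul_le_one₀ (b1 W ω) (abs_nonneg _) (b1 V ω))).const_mul 2
  have j3 : ∀ (W V : Measure X) [IsProbabilityMeasure W] [IsProbabilityMeasure V],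
      Integrable (fun ω => (∫ x, f ω x ^ 2 ∂W) + (∫ x, f ω x ^ 2 ∂V) -
        2 * ((∫ x, f ω x ∂W) * ∫ x, f ω x ∂V)) ν := fun W V _ _ =>
    ((j2 W).add (j2 V)).sub (j1 W V)
  rw [← integral_const_mul, ← integral_add (j3 P P) (j3 Q Q)]
  apply integral_mono ((j3 P P).add (j3 Q Q)) ((j3 P Q).const_mul 2)
  intro ω
  simp only [Pi.add_apply]
  nlinarith [sq_nonneg ((∫ x, f ω x ∂P) - ∫ x, f ω x ∂Q)]
end

/-- one-dimensional representation of the distance -/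
lemma abs_rep {R a b : ℝ} (ha : |a| ≤ R) (hb : |b| ≤ R) :
    ∫ u in Icc (-R) R, ((if a ≤ u then (1:ℝ) else 0) - (if b ≤ u then 1 else 0)) ^ 2 = |a - b| := by
  wlog hab : a ≤ b generalizing a b
  · rw [abs_sub_comm, ← this hb ha (le_of_not_ge hab)]
    congr 1; ext u; ring
  have : ∀ u, ((if a ≤ u then (1:ℝ) else 0) - (if b ≤ u then 1 else 0)) ^ 2 =
      (Ico a b).indicator (fun _ => 1) u := by
    intro u
    rw [indicator_apply]
    by_cases h1 : a ≤ u <;> by_cases h2 : b ≤ u <;> simp [h1, h2]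
    exact absurd (hab.trans h2) h1
  simp_rw [this]
  rw [setIntegral_indicator measurableSet_Ico, inter_eq_right.2]
  · simp [abs_sub_comm a b, abs_of_nonneg (sub_nonneg.2 hab), hab]
  · rw [abs_le] at ha hb
    intro u hu
    exact ⟨ha.1.trans hu.1, hu.2.le.trans hb.2⟩

noncomputable def cc : ℝ := 2 / Real.pi * ∫ θ in (0:ℝ)..Real.pi, |Real.cos θ| * Real.sin θ ^ 2

lemma cc_pos : 0 < cc := by
  unfold cc
  have h : ∫ θ in (0:ℝ)..Real.pi, Real.sin θ ^ 2 * Real.cos θ ^ 2 ≤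
      ∫ θ in (0:ℝ)..Real.pi, |Real.cos θ| * Real.sin θ ^ 2 := by
    apply intervalIntegral.integral_mono_on Real.pi_pos.le
    · exact Continuous.intervalIntegrable (by fun_prop) _ _
    · exact Continuous.intervalIntegrable (by fun_prop) _ _
    · intro θ _
      rw [mul_comm]
      gcongr
      rw [← sq_abs]
      nlinarith [abs_nonneg (Real.cos θ), Real.abs_cos_le_one θ]
  rw [integral_sin_sq_mul_cos_sq] at h
  have h4 : Real.sin (4 * Real.pi) = 0 := by
    have := Real.sin_nat_mul_pi 4
    simpa using this
  simp [h4] at h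
  have := Real.pi_pos
  have h5 : 0 < ∫ θ in (0:ℝ)..Real.pi, |Real.cos θ| * Real.sin θ ^ 2 := by linarith
  positivity

noncomputable def ff (ω : E4 × ℝ) (x : E4) : ℝ := if inner ℝ ω.1 x ≤ ω.2 then 1 else 0

lemma ff_meas : Measurable (Function.uncurry ff) := by
  unfold Function.uncurry ff
  exact Measurable.ite (measurableSet_le (by fun_prop) (by fun_prop)) measurable_const measurable_const

lemma ff_bound (ω : E4 × ℝ) (x : E4) : |ff ω x| ≤ 1 := by
  unfold ff; split_ifs <;> simp

noncomputable def nu : Measure (E4 × ℝ) := sph.prod (volume.restrict (Icc (-2) 2))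

instance : IsFiniteMeasure nu := by unfold nu; infer_instance

lemma norm_rep {x y : E4} (hx : ‖x‖ ≤ 2) (hy : ‖y‖ ≤ 2) :
    ∫ ω, (ff ω x - ff ω y) ^ 2 ∂nu = cc * ‖x - y‖ := by
  have hm : ∀ x, Measurable (fun ω => ff ω x) := fun x =>
    ff_meas.comp (by fun_prop : Measurable fun ω : E4 × ℝ => (ω, x))
  have hint : Integrable (fun ω => (ff ω x - ff ω y) ^ 2) nu := by
    refine bdd_int (M := 4) (((hm x).sub (hm y)).pow_const 2).stronglyMeasurable (fun ω => ?_)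
    have h1 := abs_le.1 (ff_bound ω x)
    have h2 := abs_le.1 (ff_bound ω y)
    rw [abs_of_nonneg (sq_nonneg _)]
    nlinarith
  unfold nu at hint ⊢
  rw [integral_prod _ hint]
  have h1 : ∀ᵐ ξ ∂sph, ∫ u in Icc (-2:ℝ) 2, (ff (ξ, u) x - ff (ξ, u) y) ^ 2 = |inner ℝ ξ (x - y)| := by
    filter_upwards [sph_norm] with ξ hξ
    rw [inner_sub_right]
    refine abs_rep (R := 2) (a := inner ℝ ξ x) (b := inner ℝ ξ y) ?_ ?_
    · exact (abs_real_inner_le_norm _ _).trans (by rw [hξ, one_mul]; exact hx)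
    · exact (abs_real_inner_le_norm _ _).trans (by rw [hξ, one_mul]; exact hy)
  rw [integral_congr_ae h1, sph_int (f := fun s => |s|) continuous_abs, cc]
  simp_rw [abs_mul, abs_norm, mul_assoc]
  rw [intervalIntegral.integral_const_mul]
  ring

lemma pair_rep (P Q : Measure E4) (hP : ∀ᵐ x ∂P, ‖x‖ ≤ 2) (hQ : ∀ᵐ x ∂Q, ‖x‖ ≤ 2) :
    ∫ x, ∫ y, ∫ ω, (ff ω x - ff ω y) ^ 2 ∂nu ∂Q ∂P = cc * ∫ x, ∫ y, ‖x - y‖ ∂Q ∂P := by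
  rw [← integral_const_mul]
  apply integral_congr_ae
  filter_upwards [hP] with x hx
  rw [← integral_const_mul]
  apply integral_congr_ae
  filter_upwards [hQ] with y hy
  exact norm_rep hx hy

lemma pot (x : E4) : ∫ y, ‖x - y‖ ∂sph = 2 / Real.pi * AA ‖x‖ := by
  have h1 : ∀ᵐ y ∂sph, ‖x - y‖ = Real.sqrt (1 + ‖x‖ ^ 2 - 2 * inner ℝ y x) := by
    filter_upwards [sph_norm] with y hy
    rw [← Real.sqrt_sq (norm_nonneg (x - y)), norm_sub_sq_real, hy, real_inner_comm]
    congr 1; ring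
  rw [integral_congr_ae h1, sph_int (f := fun s => Real.sqrt (1 + ‖x‖ ^ 2 - 2 * s)) (by fun_prop)]
  unfold AA rr
  simp_rw [mul_assoc]

lemma main_E4 (P : Measure E4) [IsProbabilityMeasure P] (hP : ∀ᵐ x ∂P, ‖x‖ ≤ 2)
    (h2 : ∫ x, ‖x‖ ^ 2 ∂P = 1) : ∫ x, ∫ y, ‖x - y‖ ∂P ∂P ≤ 64 / (15 * Real.pi) := by
  have hS : ∀ᵐ x ∂sph, ‖x‖ ≤ 2 := by
    filter_upwards [sph_norm] with x hx
    rw [hx]; norm_num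
  have hen := energy nu P sph ff_meas ff_bound
  rw [pair_rep P P hP hP, pair_rep sph sph hS hS, pair_rep P sph hP hS] at hen
  have h3 : ∫ x, ∫ y, ‖x - y‖ ∂sph ∂sph = 64 / (15 * Real.pi) := by
    have : ∀ᵐ x ∂sph, ∫ y, ‖x - y‖ ∂sph = 64 / (15 * Real.pi) := by
      filter_upwards [sph_norm] with x hx
      rw [pot, hx, AA_one]
      have := Real.pi_pos
      field_simp; norm_num
    rw [integral_congr_ae this]
    simp
  have hi2 : Integrable (fun x : E4 => ‖x‖ ^ 2) P := by
    refine Integrable.of_bound (Continuous.aestronglyMeasurable (by fun_prop)) 4 ?_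
    filter_upwards [hP] with x hx
    rw [Real.norm_eq_abs, abs_of_nonneg (by positivity)]
    nlinarith [norm_nonneg x]
  have h4 : ∫ x, ∫ y, ‖x - y‖ ∂sph ∂P ≤ 64 / (15 * Real.pi) := by
    simp_rw [pot]
    have hi3 : Integrable (fun x : E4 => 16 / (15 * Real.pi) * (3 + ‖x‖ ^ 2)) P :=
      ((integrable_const _).add hi2).const_mul _
    calc ∫ x, 2 / Real.pi * AA ‖x‖ ∂P ≤ ∫ x, 16 / (15 * Real.pi) * (3 + ‖x‖ ^ 2) ∂P := by
          have hb : ∀ x : E4, 2 / Real.pi * AA ‖x‖ ≤ 16 / (15 * Real.pi) * (3 + ‖x‖ ^ 2) := by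
            intro x
            have := Real.pi_pos
            calc _ ≤ 2 / Real.pi * (8 / 15 * (3 + ‖x‖ ^ 2)) := by
                  gcongr; exact AA_le (norm_nonneg x)
              _ = _ := by field_simp; norm_num
          refine integral_mono ?_ hi3 hb
          refine hi3.mono' ?_ (Filter.Eventually.of_forall fun x => ?_)
          · have := AA_cont
            exact Continuous.aestronglyMeasurable (by fun_prop)
          · rw [← pot, Real.norm_eq_abs, abs_of_nonneg (integral_nonneg fun y => norm_nonneg _), pot]
            exact hb x
      _ = _ := by
          rw [integral_const_mul, integral_add (integrable_const _) hi2, h2]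
          simp
          field_simp; norm_num
  rw [h3] at hen
  have := cc_pos
  have h5 : cc * ∫ x, ∫ y, ‖x - y‖ ∂P ∂P ≤ cc * (64 / (15 * Real.pi)) := by
    nlinarith [mul_le_mul_of_nonneg_left h4 this.le]
  exact le_of_mul_le_mul_left h5 this

noncomputable def TT (x : Fin 4 → ℝ) : E4 :=
  WithLp.toLp 2 (Real.sqrt 3 * (x 0 - 1 / 2),
    WithLp.toLp 2 (fun i : Fin 3 => Real.sqrt 3 * (x i.succ - 1 / 2)))

lemma TT_meas : Measurable TT := by
  unfold TT
  refine (WithLp.measurable_toLp 2 _).comp ?_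
  refine Measurable.prodMk (by fun_prop) ?_
  refine (WithLp.measurable_toLp 2 _).comp ?_
  fun_prop

lemma TT_norm (x : Fin 4 → ℝ) : ‖TT x‖ ^ 2 = 3 * ∑ i, (x i - 1 / 2) ^ 2 := by
  unfold TT
  rw [WithLp.prod_norm_sq_eq_of_L2]
  simp only [EuclideanSpace.norm_sq_eq, Real.norm_eq_abs, sq_abs, WithLp.toLp_fst, WithLp.toLp_snd, mul_pow]
  rw [Real.sq_sqrt (by norm_num), ← Finset.mul_sum, Fin.sum_univ_succ (n := 3)]
  ring

lemma TT_sub (x y : Fin 4 → ℝ) : ‖TT x - TT y‖ = Real.sqrt 3 * dist2 x y := by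
  unfold dist2
  rw [← Real.sqrt_mul (by norm_num), ← Real.sqrt_sq (norm_nonneg (TT x - TT y))]
  congr 1
  unfold TT
  rw [WithLp.prod_norm_sq_eq_of_L2]
  simp only [EuclideanSpace.norm_sq_eq, Real.norm_eq_abs, sq_abs, WithLp.sub_fst, WithLp.sub_snd,
    WithLp.toLp_fst, WithLp.toLp_snd,
    PiLp.sub_apply, ← mul_sub, mul_pow, sub_sub_sub_cancel_right]
  rw [Real.sq_sqrt (by norm_num), ← Finset.mul_sum, Fin.sum_univ_succ (n := 3)]
  ring

/-- for every copula `C` on `[0,1]⁴`, `S(C,C) ≤ 64/(15·π·√3)`. -/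
theorem stmt12 (C : Measure (Fin 4 → ℝ)) (hC : IsCopula 4 C) :
    S 4 C C ≤ 64 / (15 * Real.pi * Real.sqrt 3) := by
  obtain ⟨hprob, hmarg⟩ := hC
  have hP : IsProbabilityMeasure (C.map TT) := Measure.isProbabilityMeasure_map TT_meas.aemeasurable
  have hcoord : ∀ i : Fin 4, ∀ᵐ x ∂C, x i ∈ Icc (0:ℝ) 1 := by
    intro i
    have h : ∀ᵐ t ∂(C.map (fun x => x i)), t ∈ Icc (0:ℝ) 1 := by
      rw [hmarg i, uniform01]
      exact ae_restrict_mem measurableSet_Icc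
    exact ae_of_ae_map (measurable_pi_apply i).aemeasurable h
  have hsq : ∀ᵐ x ∂C, ∀ i : Fin 4, (x i - 1 / 2) ^ 2 ≤ 1 / 4 := by
    rw [ae_all_iff]
    intro i
    filter_upwards [hcoord i] with x hx
    nlinarith [hx.1, hx.2]
  have hbd : ∀ᵐ x ∂(C.map TT), ‖x‖ ≤ 2 := by
    rw [ae_map_iff TT_meas.aemeasurable (measurableSet_le (by fun_prop) (by fun_prop))]
    filter_upwards [hsq] with x hx
    have h1 := TT_norm x
    rw [Fin.sum_univ_four] at h1
    nlinarith [hx 0, hx 1, hx 2, hx 3, norm_nonneg (TT x)]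
  have hmom : ∀ i : Fin 4, ∫ x, (x i - 1 / 2) ^ 2 ∂C = 1 / 12 := by
    intro i
    have h := integral_map (μ := C) (φ := fun x : Fin 4 → ℝ => x i) (measurable_pi_apply i).aemeasurable
      (f := fun t : ℝ => (t - 1 / 2) ^ 2) (Continuous.aestronglyMeasurable (by fun_prop))
    rw [← h, hmarg i, uniform01, integral_Icc_eq_integral_Ioc,
      ← intervalIntegral.integral_of_le zero_le_one,
      intervalIntegral.integral_comp_sub_right (fun t => t ^ 2)]
    simp; norm_num
  have h2 : ∫ x, ‖x‖ ^ 2 ∂(C.map TT) = 1 := by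
    rw [integral_map TT_meas.aemeasurable (Continuous.aestronglyMeasurable (by fun_prop))]
    simp_rw [TT_norm]
    rw [integral_const_mul, integral_finsetSum]
    · simp_rw [hmom]; simp; norm_num
    · intro i _
      refine Integrable.of_bound (Continuous.aestronglyMeasurable (by fun_prop)) (1 / 4) ?_
      filter_upwards [hsq] with x hx
      rw [Real.norm_eq_abs, abs_of_nonneg (sq_nonneg _)]
      exact hx i
  have hmain := main_E4 (C.map TT) hbd h2
  have h3 : ∫ x, ∫ y, ‖x - y‖ ∂(C.map TT) ∂(C.map TT) = Real.sqrt 3 * S 4 C C := by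
    rw [integral_map TT_meas.aemeasurable]
    · unfold S
      rw [← integral_const_mul]
      congr 1
      ext x
      rw [integral_map TT_meas.aemeasurable (Continuous.aestronglyMeasurable (by fun_prop)),
        ← integral_const_mul]
      simp_rw [TT_sub]
    · have : StronglyMeasurable (fun p : E4 × E4 => ‖p.1 - p.2‖) :=
        Continuous.stronglyMeasurable (by fun_prop)
      exact this.integral_prod_right'.aestronglyMeasurable
  rw [h3] at hmain
  have h4 : 0 < Real.sqrt 3 := by positivity
  rw [← div_div, le_div_iff₀ h4, mul_comm]
  exact hmain
end
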